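/- arXiv:2507.12246 — 2 statements merged into one kernel-verified Lean document; each statement's English description precedes it below -/
import Mathlib

section
/- (L^∞ smoothness of the semi-dual) For all φ, φ̄ ∈ L¹(ν) for which J(φ) and J(φ̄) are finite, J(φ̄) − J(φ) − ⟨δJ(φ), φ̄ − φ⟩ ≥ − ‖φ̄ − φ‖²_{L^∞(𝒴)} / 2, where ⟨f,g⟩ := ∫_𝒴 f(y)g(y) dy and ‖·‖_{L^∞(𝒴)} is the essential supremum norm on 𝒴. -/
open MeasureTheory

noncomputable section

variable {d : ℕ}

/-- `φ⁺(x) = log ∫ exp(φ(y) - c(x,y)/ε) dν(y)`, with `ν` the density of the marginal on `𝒴`. -/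
def phiPlus (ν : (Fin d → ℝ) → ℝ) (c : (Fin d → ℝ) → (Fin d → ℝ) → ℝ) (ε : ℝ)
    (φ : (Fin d → ℝ) → ℝ) (x : Fin d → ℝ) : ℝ :=
  Real.log (∫ y, Real.exp (φ y - c x y / ε) * ν y)

/-- The semi-dual `J(φ) = ∫ φ dν - ∫ φ⁺ dμ`. -/
def semiDual (μ ν : (Fin d → ℝ) → ℝ) (c : (Fin d → ℝ) → (Fin d → ℝ) → ℝ) (ε : ℝ)
    (φ : (Fin d → ℝ) → ℝ) : ℝ :=
  (∫ y, φ y * ν y) - ∫ x, phiPlus ν c ε φ x * μ x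

/-- The joint density `π(φ, φ⁺)(x,y) = exp(φ(y) - φ⁺(x) - c(x,y)/ε) μ(x) ν(y)`. -/
def piJoint (μ ν : (Fin d → ℝ) → ℝ) (c : (Fin d → ℝ) → (Fin d → ℝ) → ℝ) (ε : ℝ)
    (φ : (Fin d → ℝ) → ℝ) (z : (Fin d → ℝ) × (Fin d → ℝ)) : ℝ :=
  Real.exp (φ z.2 - phiPlus ν c ε φ z.1 - c z.1 z.2 / ε) * μ z.1 * ν z.2

/-- The `𝒴`-marginal density of `π(φ, φ⁺)`. -/
def piY (μ ν : (Fin d → ℝ) → ℝ) (c : (Fin d → ℝ) → (Fin d → ℝ) → ℝ) (ε : ℝ)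
    (φ : (Fin d → ℝ) → ℝ) (y : Fin d → ℝ) : ℝ :=
  ∫ x, piJoint μ ν c ε φ (x, y)

/-- First variation of the semi-dual: `δJ(φ) = ν - π(φ,φ⁺)_𝒴`. -/
def deltaJ (μ ν : (Fin d → ℝ) → ℝ) (c : (Fin d → ℝ) → (Fin d → ℝ) → ℝ) (ε : ℝ)
    (φ : (Fin d → ℝ) → ℝ) (y : Fin d → ℝ) : ℝ :=
  ν y - piY μ ν c ε φ y

/-- Hoeffding's lemma for a probability density `p` with respect to `m`. -/
lemma log_integral_exp_mul_le {α : Type*} [MeasurableSpace α] {m : Measure α} {p h : α → ℝ} {M : ℝ}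
    (hp0 : ∀ y, 0 ≤ p y) (hpm : Measurable p) (hp : Integrable p m) (hp1 : ∫ y, p y ∂m = 1)
    (hh : Measurable h) (hb : ∀ᵐ y ∂m, |h y| ≤ M) (hpos : 0 < ∫ y, Real.exp (h y) * p y ∂m) :
    Real.log (∫ y, Real.exp (h y) * p y ∂m) ≤ (∫ y, p y * h y ∂m) + M ^ 2 / 2 := by
  set P : Measure α := m.withDensity fun y => ENNReal.ofReal (p y)
  have hP : IsProbabilityMeasure P := by
    refine ⟨?_⟩
    rw [withDensity_apply _ MeasurableSet.univ, Measure.restrict_univ,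
      ← ofReal_integral_eq_lintegral_ofReal hp (ae_of_all _ hp0), hp1, ENNReal.ofReal_one]
  have hint (f : α → ℝ) : ∫ y, f y ∂P = ∫ y, p y * f y ∂m := by
    rw [integral_withDensity_eq_integral_toReal_smul hpm.ennreal_ofReal
      (ae_of_all _ fun _ => ENNReal.ofReal_lt_top)]
    simp only [ENNReal.toReal_ofReal (hp0 _), smul_eq_mul]
  have hbP : ∀ᵐ y ∂P, h y ∈ Set.Icc (-M) M :=
    (withDensity_absolutelyContinuous m _).ae_le (hb.mono fun y hy => abs_le.mp hy)
  have key := (ProbabilityTheory.hasSubgaussianMGF_of_mem_Icc hh.aemeasurable hbP).mgf_le 1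
  have hmgf : ProbabilityTheory.mgf (fun y => h y - ∫ z, h z ∂P) P 1 =
      (∫ y, Real.exp (h y) * p y ∂m) * Real.exp (-∫ y, p y * h y ∂m) := by
    simp only [ProbabilityTheory.mgf, one_mul, sub_eq_add_neg, Real.exp_add, integral_mul_const]
    simp only [hint, mul_comm (p _) (Real.exp _)]
  have hexponent : (((‖M - -M‖₊ / 2) ^ 2 : NNReal) : ℝ) * 1 ^ 2 / 2 = M ^ 2 / 2 := by
    push_cast
    rw [Real.norm_eq_abs, div_pow, sq_abs]
    ring
  rw [hmgf, hexponent, Real.exp_neg, ← div_eq_mul_inv, div_le_iff₀ (Real.exp_pos _),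
    ← Real.exp_add] at key
  rw [Real.log_le_iff_le_exp hpos, add_comm]
  exact key

/-- Density of the conditional law of `y` given `x` under `π(φ, φ⁺)`. -/
def condDensity (ν : (Fin d → ℝ) → ℝ) (c : (Fin d → ℝ) → (Fin d → ℝ) → ℝ) (ε : ℝ)
    (φ : (Fin d → ℝ) → ℝ) (x y : Fin d → ℝ) : ℝ :=
  Real.exp (φ y - phiPlus ν c ε φ x - c x y / ε) * ν y

section

variable {μ ν : (Fin d → ℝ) → ℝ} {c : (Fin d → ℝ) → (Fin d → ℝ) → ℝ} {ε : ℝ}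
  {φ ψ : (Fin d → ℝ) → ℝ}

lemma piJoint_eq_condDensity_mul (x y : Fin d → ℝ) :
    piJoint μ ν c ε φ (x, y) = condDensity ν c ε φ x y * μ x := by
  simp only [piJoint, condDensity]
  ring

lemma exp_mul_condDensity {x : Fin d → ℝ}
    (hpos : 0 < ∫ y, Real.exp (φ y - c x y / ε) * ν y) (t : ℝ) (y : Fin d → ℝ) :
    Real.exp t * condDensity ν c ε φ x y =
      (∫ y, Real.exp (φ y - c x y / ε) * ν y)⁻¹ *
        (Real.exp (φ y + t - c x y / ε) * ν y) := by
  have hG : Real.exp (phiPlus ν c ε φ x) = ∫ y, Real.exp (φ y - c x y / ε) * ν y :=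
    Real.exp_log hpos
  rw [← hG, condDensity, ← Real.exp_neg, ← mul_assoc, ← mul_assoc, ← Real.exp_add, ← Real.exp_add]
  congr 2
  ring

lemma condDensity_eq {x : Fin d → ℝ}
    (hpos : 0 < ∫ y, Real.exp (φ y - c x y / ε) * ν y) (y : Fin d → ℝ) :
    condDensity ν c ε φ x y =
      (∫ y, Real.exp (φ y - c x y / ε) * ν y)⁻¹ * (Real.exp (φ y - c x y / ε) * ν y) := by
  simpa using exp_mul_condDensity hpos 0 y

lemma integrable_condDensity {x : Fin d → ℝ}
    (hpos : 0 < ∫ y, Real.exp (φ y - c x y / ε) * ν y) :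
    Integrable (condDensity ν c ε φ x) := by
  have hw : Integrable fun y => Real.exp (φ y - c x y / ε) * ν y :=
    Integrable.of_integral_ne_zero hpos.ne'
  exact (hw.const_mul _).congr (ae_of_all _ fun y => (condDensity_eq hpos y).symm)

lemma integral_condDensity {x : Fin d → ℝ}
    (hpos : 0 < ∫ y, Real.exp (φ y - c x y / ε) * ν y) :
    ∫ y, condDensity ν c ε φ x y = 1 := by
  simp only [condDensity_eq hpos, integral_const_mul]
  exact inv_mul_cancel₀ hpos.ne'

lemma measurable_phiPlus (hc : Measurable (Function.uncurry c)) (hνm : Measurable ν)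
    (hφm : Measurable φ) : Measurable (phiPlus ν c ε φ) := by
  have hc' : Measurable fun z : (Fin d → ℝ) × (Fin d → ℝ) => c z.1 z.2 := hc
  have hw : Measurable fun z : (Fin d → ℝ) × (Fin d → ℝ) =>
      Real.exp (φ z.2 - c z.1 z.2 / ε) * ν z.2 := by fun_prop
  exact hw.stronglyMeasurable.integral_prod_right'.measurable.log

lemma measurable_condDensity (hc : Measurable (Function.uncurry c)) (hνm : Measurable ν)
    (hφm : Measurable φ) : Measurable (Function.uncurry (condDensity ν c ε φ)) := by
  have hc' : Measurable fun z : (Fin d → ℝ) × (Fin d → ℝ) => c z.1 z.2 := hc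
  have hp := measurable_phiPlus (ε := ε) hc hνm hφm
  simp only [Function.uncurry_def, condDensity]
  fun_prop

lemma integrable_piJoint (hμ0 : ∀ x, 0 ≤ μ x) (hν0 : ∀ y, 0 ≤ ν y) (hμm : Measurable μ)
    (hνm : Measurable ν) (hμ : Integrable μ) (hc : Measurable (Function.uncurry c))
    (hφm : Measurable φ) (hpos : ∀ x, 0 < ∫ y, Real.exp (φ y - c x y / ε) * ν y) :
    Integrable (piJoint μ ν c ε φ) (volume.prod volume) := by
  have hm : Measurable (piJoint μ ν c ε φ) := by
    have h := (measurable_condDensity (ε := ε) hc hνm hφm).mul (hμm.comp measurable_fst)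
    convert h using 1
    ext ⟨x, y⟩
    exact piJoint_eq_condDensity_mul x y
  have h0 (x y : Fin d → ℝ) : 0 ≤ piJoint μ ν c ε φ (x, y) :=
    mul_nonneg (mul_nonneg (Real.exp_pos _).le (hμ0 x)) (hν0 y)
  rw [integrable_prod_iff hm.aestronglyMeasurable]
  constructor
  · refine ae_of_all _ fun x => ?_
    simp only [piJoint_eq_condDensity_mul]
    exact (integrable_condDensity (hpos x)).mul_const _
  · simp only [Real.norm_of_nonneg (h0 _ _)]
    simpa only [piJoint_eq_condDensity_mul, integral_mul_const,
      integral_condDensity (hpos _), one_mul] using hμ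

lemma phiPlus_le_add (hν0 : ∀ y, 0 ≤ ν y) (hνm : Measurable ν)
    (hc : Measurable (Function.uncurry c)) (hφm : Measurable φ) (hψm : Measurable ψ)
    {x : Fin d → ℝ} (hpos : 0 < ∫ y, Real.exp (φ y - c x y / ε) * ν y)
    (hposb : 0 < ∫ y, Real.exp (ψ y - c x y / ε) * ν y) {M : ℝ}
    (hM : ∀ᵐ y ∂(volume : Measure (Fin d → ℝ)), |ψ y - φ y| ≤ M) :
    phiPlus ν c ε ψ x ≤
      phiPlus ν c ε φ x + (∫ y, condDensity ν c ε φ x y * (ψ y - φ y)) + M ^ 2 / 2 := by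
  have hratio : ∫ y, Real.exp (ψ y - φ y) * condDensity ν c ε φ x y =
      (∫ y, Real.exp (φ y - c x y / ε) * ν y)⁻¹ * ∫ y, Real.exp (ψ y - c x y / ε) * ν y := by
    simp only [exp_mul_condDensity hpos, integral_const_mul, add_sub_cancel]
  have key := log_integral_exp_mul_le (p := condDensity ν c ε φ x) (h := fun y => ψ y - φ y)
    (fun y => mul_nonneg (Real.exp_pos _).le (hν0 y))
    ((measurable_condDensity hc hνm hφm).of_uncurry_left) (integrable_condDensity hpos)
    (integral_condDensity hpos) (hψm.sub hφm) hM
    (by rw [hratio]; exact mul_pos (inv_pos.mpr hpos) hposb)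
  rw [hratio, Real.log_mul (inv_ne_zero hpos.ne') hposb.ne', Real.log_inv] at key
  simp only [phiPlus]
  linarith

end

/-- `L^∞` smoothness of the semi-dual.
For all `φ, φ̄ ∈ L¹(ν)` with `J(φ)`, `J(φ̄)` finite,
`J(φ̄) − J(φ) − ⟨δJ(φ), φ̄ − φ⟩ ≥ −‖φ̄ − φ‖²_{L^∞(𝒴)} / 2`.
The essential supremum bound is expressed by quantifying over all a.e. bounds `M`
on `|φ̄ − φ|`. -/
theorem semiDual_Linf_smooth
    (μ ν : (Fin d → ℝ) → ℝ) (c : (Fin d → ℝ) → (Fin d → ℝ) → ℝ) (ε : ℝ)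
    (hε : 0 < ε) (hμ0 : ∀ x, 0 ≤ μ x) (hν0 : ∀ y, 0 ≤ ν y)
    (hμm : Measurable μ) (hνm : Measurable ν)
    (hμ1 : (∫ x, μ x) = 1) (hν1 : (∫ y, ν y) = 1)
    (hc : Measurable (Function.uncurry c))
    (φ φb : (Fin d → ℝ) → ℝ) (hφm : Measurable φ) (hφbm : Measurable φb)
    (hφν : Integrable (fun y => φ y * ν y))
    (hφbν : Integrable (fun y => φb y * ν y))
    (hpos : ∀ x, 0 < ∫ y, Real.exp (φ y - c x y / ε) * ν y)
    (hposb : ∀ x, 0 < ∫ y, Real.exp (φb y - c x y / ε) * ν y)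
    (hJ : Integrable (fun x => phiPlus ν c ε φ x * μ x))
    (hJb : Integrable (fun x => phiPlus ν c ε φb x * μ x))
    (hip : Integrable (fun y => deltaJ μ ν c ε φ y * (φb y - φ y))) :
    ∀ M : ℝ, (∀ᵐ y ∂(volume : Measure (Fin d → ℝ)), |φb y - φ y| ≤ M) →
      semiDual μ ν c ε φb - semiDual μ ν c ε φ -
        ∫ y, deltaJ μ ν c ε φ y * (φb y - φ y) ≥ -(M ^ 2) / 2 := by
  intro M hM
  have hμ : Integrable μ := Integrable.of_integral_ne_zero (by simp [hμ1])
  have hhm : Measurable fun y => φb y - φ y := hφbm.sub hφm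
  have hjoint : Integrable (fun z : (Fin d → ℝ) × (Fin d → ℝ) =>
      piJoint μ ν c ε φ z * (φb z.2 - φ z.2)) (volume.prod volume) :=
    (integrable_piJoint hμ0 hν0 hμm hνm hμ hc hφm hpos).mul_bdd
      (hhm.comp measurable_snd).aestronglyMeasurable
      (Measure.quasiMeasurePreserving_snd.ae hM)
  have hswap : ∫ y, piY μ ν c ε φ y * (φb y - φ y) =
      ∫ x, (∫ y, condDensity ν c ε φ x y * (φb y - φ y)) * μ x := by
    have h := integral_integral_swap
      (f := fun x y => piJoint μ ν c ε φ (x, y) * (φb y - φ y)) hjoint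
    simp only [integral_mul_const] at h
    simp only [piY]
    rw [← h]
    simp only [piJoint_eq_condDensity_mul, ← integral_mul_const, mul_right_comm]
  have hpiY : Integrable fun y => piY μ ν c ε φ y * (φb y - φ y) := by
    simpa only [integral_mul_const] using! hjoint.integral_prod_right
  have hcond : Integrable fun x =>
      (∫ y, condDensity ν c ε φ x y * (φb y - φ y)) * μ x := by
    simpa only [piJoint_eq_condDensity_mul, ← integral_mul_const, mul_right_comm] using
      hjoint.integral_prod_left
  have hdelta : ∫ y, deltaJ μ ν c ε φ y * (φb y - φ y) =
      (∫ y, φb y * ν y) - (∫ y, φ y * ν y) - ∫ y, piY μ ν c ε φ y * (φb y - φ y) := by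
    rw [← integral_sub hφbν hφν, ← integral_sub (by exact hφbν.sub hφν) hpiY]
    congr 1 with y
    simp only [deltaJ]
    ring
  have hmono : ∫ x, phiPlus ν c ε φb x * μ x ≤
      (∫ x, phiPlus ν c ε φ x * μ x) +
        (∫ x, (∫ y, condDensity ν c ε φ x y * (φb y - φ y)) * μ x) + M ^ 2 / 2 := by
    have hconst : ∫ x, M ^ 2 / 2 * μ x = M ^ 2 / 2 := by
      rw [integral_const_mul, hμ1, mul_one]
    rw [← hconst, ← integral_add hJ hcond,
      ← integral_add (by exact hJ.add hcond) (hμ.const_mul _)]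
    refine integral_mono hJb ((hJ.add hcond).add (hμ.const_mul _)) fun x => ?_
    have h := mul_le_mul_of_nonneg_right
      (phiPlus_le_add hν0 hνm hc hφm hφbm (hpos x) (hposb x) hM) (hμ0 x)
    simpa only [add_mul] using! h
  simp only [semiDual]
  linarith
end
end

section
/- (Accelerated rate for momentum-equipped projected semi-dual ascent) Assume c(x,y) ≥ 0 for all (x,y), let B > 0 with λ(3B) := e^{6B} · E_{(x,y')∼μ⊗ν}[exp(c(x,y')/ε)] < ∞, and set S_B := { φ ∈ L²(ν) : ‖φ‖_{L^∞(𝒴)} ≤ B }. For φ with ‖φ‖_{L^∞(𝒴)} ≤ 3B and η > 0 let M(φ; η) be the minimizer over φ̄ ∈ S_B of ‖ φ̄ − (φ + η · δJ(φ)/ν) ‖²_{L²(ν)}. Take φ¹ = φ̄⁰ ∈ S_B, t₁ = 1, and iterate: φ̄^n := M(φ^n; λ(3B)^{-1}); t_{n+1} := (1 + √(1 + 4 t_n²))/2; φ^{n+1} := φ̄^n + ((t_n − 1)/t_{n+1}) · (φ̄^n − φ̄^{n−1}). Suppose φ̃* is a maximizer of J over S_B. Then for every N ≥ 1, J(φ̄^N)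 − J(φ̃*) ≥ − 2 · λ(3B) · ‖φ̄⁰ − φ̃*‖²_{L²(ν)} / (N + 1)². -/
open MeasureTheory

noncomputable section

variable {d : ℕ}

/-- `λ(B) = e^{2B} · E_{(x,y')∼μ⊗ν}[exp(c(x,y')/ε)]`. -/
def lamB (μ ν : (Fin d → ℝ) → ℝ) (c : (Fin d → ℝ) → (Fin d → ℝ) → ℝ) (ε B : ℝ) : ℝ :=
  Real.exp (2 * B) *
    ∫ z : (Fin d → ℝ) × (Fin d → ℝ), Real.exp (c z.1 z.2 / ε) * μ z.1 * ν z.2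

open ProbabilityTheory

/-- One step of projected gradient ascent, as a three-point inequality. -/
lemma projected_step_bound {E : Type*} [NormedAddCommGroup E] [InnerProductSpace ℝ E]
    {y g p χ : E} {L Jy Jp Jχ : ℝ} (hL : 0 < L)
    (hlow : Jy + inner ℝ g (p - y) - L / 2 * ‖p - y‖ ^ 2 ≤ Jp)
    (hup : Jχ ≤ Jy + inner ℝ g (χ - y))
    (hmin : ∀ s : ℝ, 0 < s → s ≤ 1 →
      ‖p - (y + L⁻¹ • g)‖ ^ 2 ≤ ‖p + s • (χ - p) - (y + L⁻¹ • g)‖ ^ 2) :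
    L / 2 * (‖p - χ‖ ^ 2 - ‖y - χ‖ ^ 2) ≤ Jp - Jχ := by
  have hvar : 0 ≤ inner ℝ (p - (y + L⁻¹ • g)) (χ - p) := by
    by_contra! hneg
    set a := inner ℝ (p - (y + L⁻¹ • g)) (χ - p) with ha
    set b := ‖χ - p‖ ^ 2 with hb
    have hb0 : 0 ≤ b := by positivity
    have key : ∀ s : ℝ, 0 < s → s ≤ 1 → 0 ≤ 2 * a + s * b := by
      intro s hs hs1
      have h := hmin s hs hs1
      rw [show p + s • (χ - p) - (y + L⁻¹ • g) = (p - (y + L⁻¹ • g)) + s • (χ - p) by abel,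
        norm_add_sq_real, inner_smul_right, norm_smul, mul_pow, Real.norm_eq_abs, sq_abs,
        ← ha, ← hb] at h
      have : 0 ≤ s * (2 * a + s * b) := by linarith
      exact nonneg_of_mul_nonneg_right this hs
    have h1 := key (-a / (-a + b + 1) ) (by apply div_pos <;> linarith)
      (by rw [div_le_one] <;> linarith)
    have hd : 0 < -a + b + 1 := by linarith
    have h2 : -a / (-a + b + 1) * b ≤ -a := by
      rw [div_mul_eq_mul_div, div_le_iff₀ hd]; nlinarith
    linarith
  have e1 : inner ℝ (p - (y + L⁻¹ • g)) (χ - p)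
      = inner ℝ (p - y) (χ - p) - L⁻¹ * inner ℝ g (χ - p) := by
    rw [show p - (y + L⁻¹ • g) = (p - y) - L⁻¹ • g by abel, inner_sub_left, inner_smul_left]
    simp
  have e2 : ‖y - χ‖ ^ 2 = ‖p - y‖ ^ 2 + 2 * inner ℝ (p - y) (χ - p) + ‖p - χ‖ ^ 2 := by
    rw [← norm_neg (y - χ), show -(y - χ) = (p - y) + (χ - p) by abel, norm_add_sq_real,
      norm_sub_rev χ p]
  have e3 : inner ℝ g (χ - y) = inner ℝ g (p - y) + inner ℝ g (χ - p) := by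
    rw [← inner_add_right]; congr 1; abel
  rw [e1] at hvar
  have h3 : inner ℝ g (χ - p) ≤ L * inner ℝ (p - y) (χ - p) := by
    have := mul_nonneg hL.le hvar
    rw [mul_sub, ← mul_assoc, mul_inv_cancel₀ hL.ne'] at this
    linarith
  rw [e2]
  linarith

lemma momentum_coeff_ge {t : ℕ → ℝ} (ht1 : t 1 = 1)
    (ht : ∀ n : ℕ, 1 ≤ n → t (n + 1) = (1 + Real.sqrt (1 + 4 * t n ^ 2)) / 2)
    (n : ℕ) (hn : 1 ≤ n) : ((n : ℝ) + 1) / 2 ≤ t n := by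
  induction n, hn using Nat.le_induction with
  | base => norm_num [ht1]
  | succ n hn ih =>
    have : 2 * t n ≤ Real.sqrt (1 + 4 * t n ^ 2) := Real.le_sqrt_of_sq_le (by nlinarith)
    rw [ht n hn]; push_cast; linarith

lemma momentum_coeff_sq {t : ℕ → ℝ}
    (ht : ∀ n : ℕ, 1 ≤ n → t (n + 1) = (1 + Real.sqrt (1 + 4 * t n ^ 2)) / 2)
    (n : ℕ) (hn : 1 ≤ n) : t (n + 1) ^ 2 - t (n + 1) = t n ^ 2 := by
  have := Real.sq_sqrt (show 0 ≤ 1 + 4 * t n ^ 2 by positivity)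
  rw [ht n hn]; nlinarith

/-- The accelerated rate in a Hilbert space, deduced from three-point inequalities. -/
lemma accelerated_rate_of_step_bounds {E : Type*} [NormedAddCommGroup E] [InnerProductSpace ℝ E]
    {x y : ℕ → E} {xs : E} {v : ℕ → ℝ} {vs L : ℝ} {t : ℕ → ℝ} (hL : 0 < L)
    (hinit : y 1 = x 0) (ht1 : t 1 = 1)
    (ht : ∀ n : ℕ, 1 ≤ n → t (n + 1) = (1 + Real.sqrt (1 + 4 * t n ^ 2)) / 2)
    (hmom : ∀ n : ℕ, 1 ≤ n → y (n + 1) = x n + ((t n - 1) / t (n + 1)) • (x n - x (n - 1)))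
    (hstar : ∀ n : ℕ, 1 ≤ n → L / 2 * (‖x n - xs‖ ^ 2 - ‖y n - xs‖ ^ 2) ≤ v n - vs)
    (hprev : ∀ n : ℕ, 1 ≤ n →
      L / 2 * (‖x n - x (n - 1)‖ ^ 2 - ‖y n - x (n - 1)‖ ^ 2) ≤ v n - v (n - 1))
    (N : ℕ) (hN : 1 ≤ N) : -(2 * L * ‖x 0 - xs‖ ^ 2) / ((N : ℝ) + 1) ^ 2 ≤ v N - vs := by
  have main : ∀ n : ℕ, 1 ≤ n →
      L / 2 * ‖t n • (x n - xs) - (t n - 1) • (x (n - 1) - xs)‖ ^ 2 + t n ^ 2 * (vs - v n)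
        ≤ L / 2 * ‖x 0 - xs‖ ^ 2 := by
    intro n hn
    induction n, hn using Nat.le_induction with
    | base =>
      have := hstar 1 le_rfl
      rw [hinit] at this
      simp only [ht1, one_smul, sub_self, zero_smul, sub_zero]
      linarith
    | succ n hn ih =>
      have hs := hstar (n + 1) (by omega)
      have hp := hprev (n + 1) (by omega)
      have hm := hmom n hn
      have hsq := momentum_coeff_sq ht n hn
      have htp : 1 ≤ t (n + 1) := by
        have := momentum_coeff_ge ht1 ht (n + 1) (by omega)
        push_cast at this
        have : (1 : ℝ) ≤ n := by exact_mod_cast hn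
        linarith
      simp only [Nat.add_sub_cancel] at hp ⊢
      set T := t (n + 1)
      have hT0 : T ≠ 0 := by linarith
      have hu : t n • (x n - xs) - (t n - 1) • (x (n - 1) - xs)
          = T • (y (n + 1) - xs) - (T - 1) • (x n - xs) := by
        have : T • y (n + 1) = T • x n + (t n - 1) • (x n - x (n - 1)) := by
          rw [hm, smul_add, smul_smul, mul_div_cancel₀ _ hT0]
        rw [smul_sub T, this]
        module
      rw [hu] at ih
      have expand : ∀ z w : E, ‖T • z - (T - 1) • w‖ ^ 2
          = T * ‖z‖ ^ 2 - (T - 1) * ‖w‖ ^ 2 + T * (T - 1) * ‖z - w‖ ^ 2 := by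
        intro z w
        rw [norm_sub_sq_real, norm_sub_sq_real, inner_smul_left, inner_smul_right, norm_smul,
          norm_smul, mul_pow, mul_pow, Real.norm_eq_abs, Real.norm_eq_abs, sq_abs, sq_abs]
        simp
        ring
      rw [expand, sub_sub_sub_cancel_right] at ih ⊢
      have h1 := mul_le_mul_of_nonneg_left hs (by linarith : 0 ≤ T)
      have h2 := mul_le_mul_of_nonneg_left hp (by nlinarith : 0 ≤ T * (T - 1))
      have h3 : (T ^ 2 - T) * (vs - v n) = t n ^ 2 * (vs - v n) := by rw [hsq]
      linarith
  have h := main N hN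
  have ht' := momentum_coeff_ge ht1 ht N hN
  have hN0 : (0 : ℝ) < (N : ℝ) + 1 := by positivity
  have hpos : 0 ≤ L / 2 * ‖t N • (x N - xs) - (t N - 1) • (x (N - 1) - xs)‖ ^ 2 := by positivity
  rw [div_le_iff₀ (by positivity)]
  by_cases hv : vs ≤ v N
  · have : 0 ≤ 2 * L * ‖x 0 - xs‖ ^ 2 := by positivity
    have : 0 ≤ (v N - vs) * ((N : ℝ) + 1) ^ 2 := mul_nonneg (by linarith) (by positivity)
    linarith
  · have h4 : (((N : ℝ) + 1) / 2) ^ 2 ≤ t N ^ 2 := by gcongr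
    have := mul_le_mul_of_nonneg_right h4 (by linarith : 0 ≤ vs - v N)
    nlinarith

section Gibbs

variable {Y : Type*} [MeasurableSpace Y] {Q : Measure Y}

lemma tilted_sub_const_eq (f : Y → ℝ) (a : ℝ) : Q.tilted (fun y => f y - a) = Q.tilted f := by
  unfold Measure.tilted
  simp_rw [Real.exp_sub, integral_div]
  congr 1
  ext y
  rw [div_div_div_cancel_right₀ (Real.exp_ne_zero a)]

variable [IsProbabilityMeasure Q] {κ f g : Y → ℝ} {R : ℝ}

lemma integrable_exp_sub (hκm : Measurable κ) (hκ0 : ∀ y, 0 ≤ κ y) (hf : Measurable f)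
    (hfR : ∀ᵐ y ∂Q, |f y| ≤ R) : Integrable (fun y => Real.exp (f y - κ y)) Q := by
  refine Integrable.of_bound (hf.sub hκm).exp.aestronglyMeasurable (Real.exp R) ?_
  filter_upwards [hfR] with y hy
  rw [Real.norm_eq_abs, Real.abs_exp]
  exact Real.exp_le_exp.2 (by linarith [hκ0 y, (abs_le.1 hy).2])

lemma integral_exp_sub_le (hκm : Measurable κ) (hκ0 : ∀ y, 0 ≤ κ y) (hf : Measurable f)
    (hfR : ∀ᵐ y ∂Q, |f y| ≤ R) : ∫ y, Real.exp (f y - κ y) ∂Q ≤ Real.exp R := by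
  have : ∫ y, Real.exp (f y - κ y) ∂Q ≤ ∫ _, Real.exp R ∂Q := by
    refine integral_mono_ae (integrable_exp_sub hκm hκ0 hf hfR) (integrable_const _) ?_
    filter_upwards [hfR] with y hy
    exact Real.exp_le_exp.2 (by linarith [hκ0 y, (abs_le.1 hy).2])
  simpa using this

lemma one_le_integral_exp (hκ0 : ∀ y, 0 ≤ κ y) (hκ : Integrable (fun y => Real.exp (κ y)) Q) :
    1 ≤ ∫ y, Real.exp (κ y) ∂Q := by
  have : ∫ _, (1 : ℝ) ∂Q ≤ ∫ y, Real.exp (κ y) ∂Q :=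
    integral_mono (integrable_const _) hκ fun y => Real.one_le_exp (hκ0 y)
  simpa using this

lemma inv_integral_exp_sub_le (hκm : Measurable κ) (hκ0 : ∀ y, 0 ≤ κ y)
    (hκ : Integrable (fun y => Real.exp (κ y)) Q) (hf : Measurable f)
    (hfR : ∀ᵐ y ∂Q, |f y| ≤ R) :
    (∫ y, Real.exp (f y - κ y) ∂Q)⁻¹ ≤ Real.exp R * ∫ y, Real.exp (κ y) ∂Q := by
  have hK := one_le_integral_exp hκ0 hκ
  set K := ∫ y, Real.exp (κ y) ∂Q with hKdef
  have hK0 : 0 < K := by linarith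
  have hlow : Real.exp (-R) * K⁻¹ ≤ ∫ y, Real.exp (f y - κ y) ∂Q := by
    have h1 : ∫ y, Real.exp (-R) * (2 * K⁻¹ - K⁻¹ ^ 2 * Real.exp (κ y)) ∂Q
        ≤ ∫ y, Real.exp (f y - κ y) ∂Q := by
      refine integral_mono_ae (((integrable_const _).sub (hκ.const_mul _)).const_mul _)
        (integrable_exp_sub hκm hκ0 hf hfR) ?_
      filter_upwards [hfR] with y hy
      have h2 : Real.exp (-R) * Real.exp (-κ y) ≤ Real.exp (f y - κ y) := by
        rw [← Real.exp_add]
        exact Real.exp_le_exp.2 (by linarith [(abs_le.1 hy).1])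
      refine le_trans (mul_le_mul_of_nonneg_left ?_ (Real.exp_pos _).le) h2
      have h3 : Real.exp (-κ y) * Real.exp (κ y) = 1 := by rw [← Real.exp_add]; simp
      have h4 := mul_nonneg (Real.exp_pos (-κ y)).le (sq_nonneg (K⁻¹ * Real.exp (κ y) - 1))
      have h5 : Real.exp (-κ y) * (K⁻¹ * Real.exp (κ y) - 1) ^ 2
          = K⁻¹ ^ 2 * (Real.exp (-κ y) * Real.exp (κ y)) * Real.exp (κ y)
            - 2 * K⁻¹ * (Real.exp (-κ y) * Real.exp (κ y)) + Real.exp (-κ y) := by ring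
      rw [h5, h3] at h4
      linarith
    rw [integral_const_mul, integral_sub (integrable_const _) (hκ.const_mul _),
      integral_const_mul (K⁻¹ ^ 2), ← hKdef] at h1
    have h6 : K⁻¹ ^ 2 * K = K⁻¹ := by field_simp
    rw [h6] at h1
    simp only [integral_const, probReal_univ, one_smul] at h1
    linarith
  calc (∫ y, Real.exp (f y - κ y) ∂Q)⁻¹ ≤ (Real.exp (-R) * K⁻¹)⁻¹ := by gcongr
    _ = Real.exp R * K := by rw [mul_inv, inv_inv, Real.exp_neg, inv_inv]

lemma gibbs_density_le (hκm : Measurable κ) (hκ0 : ∀ y, 0 ≤ κ y)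
    (hκ : Integrable (fun y => Real.exp (κ y)) Q) (hf : Measurable f)
    (hfR : ∀ᵐ y ∂Q, |f y| ≤ R) {y : Y} (hy : |f y| ≤ R) :
    Real.exp (f y - κ y) / ∫ y', Real.exp (f y' - κ y') ∂Q
      ≤ Real.exp (2 * R) * ∫ y', Real.exp (κ y') ∂Q := by
  have h1 : Real.exp (f y - κ y) ≤ Real.exp R :=
    Real.exp_le_exp.2 (by linarith [hκ0 y, (abs_le.1 hy).2])
  calc _ ≤ Real.exp R * (Real.exp R * ∫ y', Real.exp (κ y') ∂Q) := by
        rw [div_eq_mul_inv]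
        exact mul_le_mul h1 (inv_integral_exp_sub_le hκm hκ0 hκ hf hfR)
          (inv_nonneg.2 (integral_nonneg fun _ => (Real.exp_pos _).le)) (Real.exp_pos _).le
    _ = _ := by rw [two_mul, Real.exp_add, mul_assoc]

lemma integrable_of_ae_abs_le (hf : Measurable f) (hfR : ∀ᵐ y ∂Q, |f y| ≤ R) : Integrable f Q :=
  Integrable.of_bound hf.aestronglyMeasurable R hfR

lemma gibbs_variance_le (hκm : Measurable κ) (hκ0 : ∀ y, 0 ≤ κ y)
    (hκ : Integrable (fun y => Real.exp (κ y)) Q) (hf : Measurable f)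
    (hfR : ∀ᵐ y ∂Q, |f y| ≤ R) {h : Y → ℝ} {S : ℝ} (hh : Measurable h)
    (hhS : ∀ᵐ y ∂Q, |h y| ≤ S) :
    Var[h; Q.tilted fun y => f y - κ y]
      ≤ Real.exp (2 * R) * (∫ y, Real.exp (κ y) ∂Q) * ∫ y, h y ^ 2 ∂Q := by
  have hexp := integrable_exp_sub hκm hκ0 hf hfR
  have := isProbabilityMeasure_tilted hexp
  have hsq : Integrable (fun y => h y ^ 2) Q := by
    refine integrable_of_ae_abs_le (R := S ^ 2) (hh.pow_const 2) ?_
    filter_upwards [hhS] with y hy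
    rw [abs_pow]; gcongr
  refine (variance_le_expectation_sq hh.aestronglyMeasurable).trans ?_
  rw [integral_tilted, ← integral_const_mul]
  refine integral_mono_of_nonneg (ae_of_all _ fun y => ?_) (hsq.const_mul _) ?_
  · simp only [Pi.zero_apply, Pi.pow_apply, smul_eq_mul]
    have : 0 ≤ ∫ y, Real.exp (f y - κ y) ∂Q := integral_nonneg fun _ => (Real.exp_pos _).le
    positivity
  · filter_upwards [hfR] with y hy
    simp only [Pi.pow_apply, smul_eq_mul]
    exact mul_le_mul_of_nonneg_right (gibbs_density_le hκm hκ0 hκ hf hfR hy) (sq_nonneg _)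

/-- Second-order bounds on the log-partition function around `f`. -/
lemma log_partition_bounds (hκm : Measurable κ) (hκ0 : ∀ y, 0 ≤ κ y)
    (hκ : Integrable (fun y => Real.exp (κ y)) Q) (hf : Measurable f) (hg : Measurable g)
    (hfR : ∀ᵐ y ∂Q, |f y| ≤ R) (hgR : ∀ᵐ y ∂Q, |g y| ≤ R) :
    let D := Real.log (∫ y, Real.exp (g y - κ y) ∂Q) - Real.log (∫ y, Real.exp (f y - κ y) ∂Q)
      - ∫ y, (g y - f y) ∂(Q.tilted fun y => f y - κ y)
    0 ≤ D ∧ D ≤ Real.exp (2 * R) * (∫ y, Real.exp (κ y) ∂Q) / 2 * ∫ y, (g y - f y) ^ 2 ∂Q := by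
  intro D
  have hexp := integrable_exp_sub hκm hκ0 hf hfR
  have hprob := isProbabilityMeasure_tilted hexp
  set ρ := Q.tilted (fun y => f y - κ y) with hρ
  have hac : ρ ≪ Q := tilted_absolutelyContinuous _ _
  have hh : Measurable fun y => g y - f y := hg.sub hf
  have hhS : ∀ᵐ y ∂Q, |g y - f y| ≤ 2 * R := by
    filter_upwards [hfR, hgR] with y h1 h2
    linarith [abs_sub (g y) (f y)]
  have hhi : Integrable (fun y => g y - f y) ρ := integrable_of_ae_abs_le hh (hac hhS)
  set m := ∫ y, (g y - f y) ∂ρ with hm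
  set X : Y → ℝ := fun y => g y - f y - m with hX
  have hXm : Measurable X := hh.sub_const m
  have hXmean : ρ[X] = 0 := by
    rw [hX, integral_sub hhi (integrable_const _)]
    simp [hm]
  have hset : integrableExpSet X ρ = Set.univ := by
    ext u
    simp only [Set.mem_univ, iff_true]
    refine Integrable.of_bound (C := Real.exp (|u| * (2 * R + |m|)))
      (hXm.const_mul u).exp.aestronglyMeasurable ?_
    filter_upwards [hac hhS] with y hy
    rw [Real.norm_eq_abs, Real.abs_exp]
    refine Real.exp_le_exp.2 ((le_abs_self _).trans ?_)
    rw [abs_mul]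
    gcongr
    exact (abs_sub _ _).trans (by gcongr)
  obtain ⟨u, hu, hcgf⟩ := exists_cgf_eq_iteratedDeriv_two_cgf_mul (μ := ρ) (X := X) one_pos
    hXmean (by simp [hset])
  rw [← variance_tilted_mul (by simp [hset])] at hcgf
  have hD : D = cgf X ρ 1 := by
    have hZf : 0 < ∫ y, Real.exp (f y - κ y) ∂Q := integral_exp_pos hexp
    have hZg : 0 < ∫ y, Real.exp (g y - κ y) ∂Q :=
      integral_exp_pos (integrable_exp_sub hκm hκ0 hg hgR)
    have : mgf X ρ 1 = (∫ y, Real.exp (g y - κ y) ∂Q) / (∫ y, Real.exp (f y - κ y) ∂Q)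
        / Real.exp m := by
      rw [mgf, hρ, integral_tilted, ← integral_div, ← integral_div]
      refine integral_congr_ae (ae_of_all _ fun y => ?_)
      simp only [hX, one_mul, smul_eq_mul]
      rw [div_mul_eq_mul_div, ← Real.exp_add, div_right_comm, ← Real.exp_sub]
      congr 2; ring
    rw [cgf, this, Real.log_div (div_pos hZg hZf).ne' (Real.exp_ne_zero _),
      Real.log_div hZg.ne' hZf.ne', Real.log_exp]
  have htilt : ρ.tilted (u * X ·) = Q.tilted fun y => (f y + u * (g y - f y)) - κ y := by
    rw [hρ, tilted_tilted hexp, ← tilted_sub_const_eq (fun y => (f y + u * (g y - f y)) - κ y) (u * m)]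
    congr 1; ext y
    simp only [Pi.add_apply, hX]; ring
  have hvar : Var[X; ρ.tilted (u * X ·)]
      ≤ Real.exp (2 * R) * (∫ y, Real.exp (κ y) ∂Q) * ∫ y, (g y - f y) ^ 2 ∂Q := by
    have hcR : ∀ᵐ y ∂Q, |f y + u * (g y - f y)| ≤ R := by
      filter_upwards [hfR, hgR] with y h1 h2
      rw [abs_le] at h1 h2 ⊢
      have := hu.1; have := hu.2
      constructor <;> nlinarith
    have hcm : Measurable fun y => f y + u * (g y - f y) := hf.add (hh.const_mul u)
    rw [htilt]
    have := isProbabilityMeasure_tilted (integrable_exp_sub hκm hκ0 hcm hcR)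
    rw [hX, variance_sub_const hh.aestronglyMeasurable]
    exact gibbs_variance_le hκm hκ0 hκ hcm hcR hh hhS
  rw [hD, hcgf]
  have := variance_nonneg X (ρ.tilted (u * X ·))
  constructor <;> linarith

end Gibbs

section DualObjective

variable {X Y : Type*} [MeasurableSpace X] [MeasurableSpace Y]

/-- Log-partition function `x ↦ log ∫ exp(f(y) - k(x,y)) dQ(y)`. -/
def logPartition (Q : Measure Y) (k : X → Y → ℝ) (f : Y → ℝ) (x : X) : ℝ :=
  Real.log (∫ y, Real.exp (f y - k x y) ∂Q)

/-- Density, relative to `Q`, of the second marginal of the Gibbs coupling attached to `f`. -/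
def gibbsMarginal (P : Measure X) (Q : Measure Y) (k : X → Y → ℝ) (f : Y → ℝ) (y : Y) : ℝ :=
  ∫ x, Real.exp (f y - logPartition Q k f x - k x y) ∂P

/-- The semi-dual objective for general probability measures and cost `k`. -/
def dualObjective (P : Measure X) (Q : Measure Y) (k : X → Y → ℝ) (f : Y → ℝ) : ℝ :=
  (∫ y, f y ∂Q) - ∫ x, logPartition Q k f x ∂P

variable {P : Measure X} {Q : Measure Y} [IsProbabilityMeasure P] [IsProbabilityMeasure Q]
  {k : X → Y → ℝ} {f g h : Y → ℝ} {R S : ℝ}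

lemma measurable_logPartition (hk : Measurable (Function.uncurry k)) (hf : Measurable f) :
    Measurable (logPartition Q k f) := by
  have : Measurable (Function.uncurry fun x y => Real.exp (f y - k x y)) :=
    ((hf.comp measurable_snd).sub hk).exp
  exact (this.stronglyMeasurable.integral_prod_right).measurable.log

lemma exp_sub_logPartition (hk : Measurable (Function.uncurry k)) (hk0 : ∀ x y, 0 ≤ k x y)
    (hf : Measurable f) (hfR : ∀ᵐ y ∂Q, |f y| ≤ R) (x : X) (y : Y) :
    Real.exp (f y - logPartition Q k f x - k x y)
      = Real.exp (f y - k x y) / ∫ y', Real.exp (f y' - k x y') ∂Q := by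
  have hZ : 0 < ∫ y', Real.exp (f y' - k x y') ∂Q :=
    integral_exp_pos (integrable_exp_sub hk.of_uncurry_left (hk0 x) hf hfR)
  rw [sub_right_comm, Real.exp_sub, logPartition, Real.exp_log hZ]

lemma integrable_logPartition (hk : Measurable (Function.uncurry k)) (hk0 : ∀ x y, 0 ≤ k x y)
    (hint : Integrable (fun z : X × Y => Real.exp (k z.1 z.2)) (P.prod Q))
    (hf : Measurable f) (hfR : ∀ᵐ y ∂Q, |f y| ≤ R) : Integrable (logPartition Q k f) P := by
  refine Integrable.mono' (g := fun x => R + ∫ y, Real.exp (k x y) ∂Q)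
    ((integrable_const R).add hint.integral_prod_left)
    (measurable_logPartition hk hf).aestronglyMeasurable ?_
  filter_upwards [hint.prod_right_ae] with x hx
  have hkx : Measurable (k x) := hk.of_uncurry_left
  have hZ : 0 < ∫ y, Real.exp (f y - k x y) ∂Q :=
    integral_exp_pos (integrable_exp_sub hkx (hk0 x) hf hfR)
  have hK := one_le_integral_exp (hk0 x) hx
  have h1 := Real.log_le_log hZ (integral_exp_sub_le hkx (hk0 x) hf hfR)
  have h2 := Real.log_le_log (inv_pos.2 hZ) (inv_integral_exp_sub_le hkx (hk0 x) hx hf hfR)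
  have h3 := Real.log_le_sub_one_of_pos (by linarith : 0 < ∫ y, Real.exp (k x y) ∂Q)
  rw [Real.log_exp] at h1
  rw [Real.log_inv, Real.log_mul (Real.exp_ne_zero _) (by linarith), Real.log_exp] at h2
  rw [Real.norm_eq_abs, abs_le, logPartition]
  constructor <;> linarith

lemma measurable_gibbs_density (hk : Measurable (Function.uncurry k)) (hf : Measurable f) :
    Measurable fun z : X × Y => Real.exp (f z.2 - logPartition Q k f z.1 - k z.1 z.2) :=
  (((hf.comp measurable_snd).sub ((measurable_logPartition hk hf).comp measurable_fst)).sub hk).exp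

lemma integrable_mul_gibbs_density (hk : Measurable (Function.uncurry k))
    (hk0 : ∀ x y, 0 ≤ k x y)
    (hint : Integrable (fun z : X × Y => Real.exp (k z.1 z.2)) (P.prod Q))
    (hf : Measurable f) (hfR : ∀ᵐ y ∂Q, |f y| ≤ R) (hh : Measurable h)
    (hhS : ∀ᵐ y ∂Q, |h y| ≤ S) :
    Integrable (fun z : X × Y =>
      h z.2 * Real.exp (f z.2 - logPartition Q k f z.1 - k z.1 z.2)) (P.prod Q) := by
  refine Integrable.mono'
    (g := fun z : X × Y => S * (Real.exp (2 * R) * ∫ y, Real.exp (k z.1 y) ∂Q))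
    (((hint.integral_prod_left.comp_fst Q).const_mul _).const_mul _)
    ((hh.comp measurable_snd).mul (measurable_gibbs_density hk hf)).aestronglyMeasurable ?_
  filter_upwards [Measure.quasiMeasurePreserving_fst.ae hint.prod_right_ae,
    Measure.quasiMeasurePreserving_snd.ae hfR, Measure.quasiMeasurePreserving_snd.ae hhS]
    with z h1 h2 h3
  rw [norm_mul, Real.norm_eq_abs, Real.norm_eq_abs, Real.abs_exp,
    exp_sub_logPartition hk hk0 hf hfR]
  exact mul_le_mul h3 (gibbs_density_le hk.of_uncurry_left (hk0 z.1) h1 hf hfR h2)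
    (by rw [← exp_sub_logPartition hk hk0 hf hfR]; positivity) ((abs_nonneg _).trans h3)

lemma measurable_gibbsMarginal (hk : Measurable (Function.uncurry k)) (hf : Measurable f) :
    Measurable (gibbsMarginal P Q k f) :=
  ((measurable_gibbs_density (Q := Q) hk hf).stronglyMeasurable.integral_prod_left'
    (μ := P)).measurable

lemma gibbsMarginal_abs_le (hk : Measurable (Function.uncurry k)) (hk0 : ∀ x y, 0 ≤ k x y)
    (hint : Integrable (fun z : X × Y => Real.exp (k z.1 z.2)) (P.prod Q))
    (hf : Measurable f) (hfR : ∀ᵐ y ∂Q, |f y| ≤ R) :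
    ∀ᵐ y ∂Q, |gibbsMarginal P Q k f y|
      ≤ Real.exp (2 * R) * ∫ z : X × Y, Real.exp (k z.1 z.2) ∂(P.prod Q) := by
  filter_upwards [hfR] with y hy
  rw [gibbsMarginal, abs_of_nonneg (integral_nonneg fun _ => (Real.exp_pos _).le),
    integral_prod _ hint, ← integral_const_mul]
  refine integral_mono_of_nonneg (ae_of_all _ fun _ => (Real.exp_pos _).le)
    (hint.integral_prod_left.const_mul _) ?_
  filter_upwards [hint.prod_right_ae] with x hx
  rw [exp_sub_logPartition hk hk0 hf hfR]
  exact gibbs_density_le hk.of_uncurry_left (hk0 x) hx hf hfR hy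

/-- The dual objective is concave with gradient `1 - gibbsMarginal`, which is Lipschitz on the
ball of radius `R` with constant `e^{2R} E[e^k]`. -/
lemma dualObjective_bounds (hk : Measurable (Function.uncurry k)) (hk0 : ∀ x y, 0 ≤ k x y)
    (hint : Integrable (fun z : X × Y => Real.exp (k z.1 z.2)) (P.prod Q))
    (hf : Measurable f) (hg : Measurable g)
    (hfR : ∀ᵐ y ∂Q, |f y| ≤ R) (hgR : ∀ᵐ y ∂Q, |g y| ≤ R) :
    dualObjective P Q k g
        ≤ dualObjective P Q k f + ∫ y, (1 - gibbsMarginal P Q k f y) * (g y - f y) ∂Q ∧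
      dualObjective P Q k f + (∫ y, (1 - gibbsMarginal P Q k f y) * (g y - f y) ∂Q)
        - Real.exp (2 * R) * (∫ z : X × Y, Real.exp (k z.1 z.2) ∂(P.prod Q)) / 2
          * ∫ y, (g y - f y) ^ 2 ∂Q ≤ dualObjective P Q k g := by
  have hh : Measurable fun y => g y - f y := hg.sub hf
  have hhS : ∀ᵐ y ∂Q, |g y - f y| ≤ 2 * R := by
    filter_upwards [hfR, hgR] with y h1 h2
    linarith [abs_sub (g y) (f y)]
  have hhi := integrable_of_ae_abs_le hh hhS
  have hfi := integrable_of_ae_abs_le hf hfR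
  have hgi := integrable_of_ae_abs_le hg hgR
  have hAf := integrable_logPartition (P := P) hk hk0 hint hf hfR
  have hAg := integrable_logPartition (P := P) hk hk0 hint hg hgR
  have hpi := integrable_mul_gibbs_density hk hk0 hint hf hfR hh hhS
  have htilt : ∀ x, ∫ y, (g y - f y) ∂(Q.tilted fun y => f y - k x y)
      = ∫ y, (g y - f y) * Real.exp (f y - logPartition Q k f x - k x y) ∂Q := by
    intro x
    rw [integral_tilted]
    refine integral_congr_ae (ae_of_all _ fun y => ?_)
    simp only [smul_eq_mul]
    rw [exp_sub_logPartition hk hk0 hf hfR, mul_comm]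
  have hswap : ∫ x, ∫ y, (g y - f y) * Real.exp (f y - logPartition Q k f x - k x y) ∂Q ∂P
      = ∫ y, gibbsMarginal P Q k f y * (g y - f y) ∂Q := by
    rw [integral_integral_swap hpi]
    refine integral_congr_ae (ae_of_all _ fun y => ?_)
    simp only
    rw [integral_const_mul, gibbsMarginal, mul_comm]
  have hwi : Integrable (fun y => gibbsMarginal P Q k f y * (g y - f y)) Q := by
    refine hpi.integral_prod_right.congr (ae_of_all _ fun y => ?_)
    simp only
    rw [integral_const_mul, gibbsMarginal, mul_comm]
  have hgrad : ∫ y, (1 - gibbsMarginal P Q k f y) * (g y - f y) ∂Q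
      = (∫ y, g y ∂Q) - (∫ y, f y ∂Q) - ∫ y, gibbsMarginal P Q k f y * (g y - f y) ∂Q := by
    rw [← integral_sub hgi hfi, ← integral_sub hhi hwi]
    refine integral_congr_ae (ae_of_all _ fun y => ?_)
    simp only; ring
  have hDi : Integrable (fun x => logPartition Q k g x - logPartition Q k f x
      - ∫ y, (g y - f y) * Real.exp (f y - logPartition Q k f x - k x y) ∂Q) P :=
    (hAg.sub hAf).sub hpi.integral_prod_left
  have hDint : ∫ x, (logPartition Q k g x - logPartition Q k f x
      - ∫ y, (g y - f y) * Real.exp (f y - logPartition Q k f x - k x y) ∂Q) ∂P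
      = (∫ x, logPartition Q k g x ∂P) - (∫ x, logPartition Q k f x ∂P)
        - ∫ y, gibbsMarginal P Q k f y * (g y - f y) ∂Q := by
    have hA : Integrable (fun x => logPartition Q k g x - logPartition Q k f x) P := hAg.sub hAf
    have hG : Integrable (fun x => ∫ y, (g y - f y)
      * Real.exp (f y - logPartition Q k f x - k x y) ∂Q) P := hpi.integral_prod_left
    rw [integral_sub hA hG, integral_sub hAg hAf, hswap]
  have hpt : ∀ᵐ x ∂P, _ := hint.prod_right_ae.mono fun x hx =>
    log_partition_bounds hk.of_uncurry_left (hk0 x) hx hf hg hfR hgR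
  simp only [htilt] at hpt
  have hlo := integral_nonneg_of_ae (hpt.mono fun x hx => hx.1)
  have hhi' := integral_mono_ae hDi
    (((hint.integral_prod_left.const_mul (Real.exp (2 * R))).div_const 2).mul_const
      (∫ y, (g y - f y) ^ 2 ∂Q)) (hpt.mono fun x hx => hx.2)
  rw [integral_mul_const, integral_div, integral_const_mul, ← integral_prod _ hint] at hhi'
  have hlo' := hlo.trans_eq hDint
  rw [hDint] at hhi'
  rw [hgrad, dualObjective, dualObjective]
  constructor <;> linarith

end DualObjective

section SquareIntegrable

variable {Y : Type*} [MeasurableSpace Y]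

open Classical in
/-- The class of `f` in `L²(Q)`, with junk value `0` when `f` is not square integrable. -/
def toL2 (Q : Measure Y) (f : Y → ℝ) : Lp ℝ 2 Q :=
  if h : MemLp f 2 Q then h.toLp f else 0

variable {Q : Measure Y} {f g : Y → ℝ}

lemma toL2_eq_toLp (hf : MemLp f 2 Q) : toL2 Q f = hf.toLp f := dif_pos hf

lemma toL2_add (hf : MemLp f 2 Q) (hg : MemLp g 2 Q) :
    toL2 Q (fun y => f y + g y) = toL2 Q f + toL2 Q g := by
  rw [toL2_eq_toLp hf, toL2_eq_toLp hg, toL2_eq_toLp (f := fun y => f y + g y) (hf.add hg)]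
  rfl

lemma toL2_sub (hf : MemLp f 2 Q) (hg : MemLp g 2 Q) :
    toL2 Q (fun y => f y - g y) = toL2 Q f - toL2 Q g := by
  rw [toL2_eq_toLp hf, toL2_eq_toLp hg, toL2_eq_toLp (f := fun y => f y - g y) (hf.sub hg)]
  rfl

lemma toL2_const_mul (a : ℝ) (hf : MemLp f 2 Q) :
    toL2 Q (fun y => a * f y) = a • toL2 Q f := by
  rw [toL2_eq_toLp hf, toL2_eq_toLp (hf.const_mul a)]
  rfl

lemma inner_toL2 (hf : MemLp f 2 Q) (hg : MemLp g 2 Q) :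
    inner ℝ (toL2 Q f) (toL2 Q g) = ∫ y, f y * g y ∂Q := by
  rw [toL2_eq_toLp hf, toL2_eq_toLp hg, L2.inner_def]
  refine integral_congr_ae ?_
  filter_upwards [hf.coeFn_toLp, hg.coeFn_toLp] with y h1 h2
  simp [h1, h2, mul_comm]

lemma norm_toL2_sub_sq (hf : MemLp f 2 Q) (hg : MemLp g 2 Q) :
    ‖toL2 Q f - toL2 Q g‖ ^ 2 = ∫ y, (f y - g y) ^ 2 ∂Q := by
  have h : MemLp (fun y => f y - g y) 2 Q := hf.sub hg
  rw [← toL2_sub hf hg, ← real_inner_self_eq_norm_sq, inner_toL2 h h]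
  simp_rw [sq]

lemma memLp_of_ae_abs_le [IsFiniteMeasure Q] {R : ℝ} (hf : Measurable f)
    (hfR : ∀ᵐ y ∂Q, |f y| ≤ R) : MemLp f 2 Q :=
  MemLp.of_bound hf.aestronglyMeasurable R hfR

end SquareIntegrable

/-- Projected ascent on the dual objective satisfies the three-point inequality. -/
lemma dualObjective_projected_step {X Y : Type*} [MeasurableSpace X] [MeasurableSpace Y]
    {P : Measure X} {Q : Measure Y} [IsProbabilityMeasure P] [IsProbabilityMeasure Q]
    {k : X → Y → ℝ} {f p χ : Y → ℝ} {R L : ℝ}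
    (hk : Measurable (Function.uncurry k)) (hk0 : ∀ x y, 0 ≤ k x y)
    (hint : Integrable (fun z : X × Y => Real.exp (k z.1 z.2)) (P.prod Q))
    (hL : L = Real.exp (2 * R) * ∫ z : X × Y, Real.exp (k z.1 z.2) ∂(P.prod Q)) (hL0 : 0 < L)
    (hf : Measurable f) (hp : Measurable p) (hχ : Measurable χ)
    (hfR : ∀ᵐ y ∂Q, |f y| ≤ R) (hpR : ∀ᵐ y ∂Q, |p y| ≤ R) (hχR : ∀ᵐ y ∂Q, |χ y| ≤ R)
    (hmin : ∀ s : ℝ, 0 < s → s ≤ 1 →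
      ∫ y, (p y - (f y + L⁻¹ * (1 - gibbsMarginal P Q k f y))) ^ 2 ∂Q
        ≤ ∫ y, (p y + s * (χ y - p y)
          - (f y + L⁻¹ * (1 - gibbsMarginal P Q k f y))) ^ 2 ∂Q) :
    L / 2 * (‖toL2 Q p - toL2 Q χ‖ ^ 2 - ‖toL2 Q f - toL2 Q χ‖ ^ 2)
      ≤ dualObjective P Q k p - dualObjective P Q k χ := by
  have mf := memLp_of_ae_abs_le hf hfR
  have mp := memLp_of_ae_abs_le hp hpR
  have mχ := memLp_of_ae_abs_le hχ hχR
  have mg : MemLp (fun y => 1 - gibbsMarginal P Q k f y) 2 Q :=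
    (memLp_const 1).sub (memLp_of_ae_abs_le (measurable_gibbsMarginal hk hf)
      (gibbsMarginal_abs_le hk hk0 hint hf hfR))
  have hinner : ∀ {h : Y → ℝ}, MemLp h 2 Q →
      inner ℝ (toL2 Q fun y => 1 - gibbsMarginal P Q k f y) (toL2 Q h - toL2 Q f)
        = ∫ y, (1 - gibbsMarginal P Q k f y) * (h y - f y) ∂Q := by
    intro h mh
    rw [← toL2_sub mh mf]
    exact inner_toL2 mg (mh.sub mf)
  have mtarget : MemLp (fun y => f y + L⁻¹ * (1 - gibbsMarginal P Q k f y)) 2 Q :=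
    mf.add (mg.const_mul _)
  have etarget : toL2 Q f + L⁻¹ • toL2 Q (fun y => 1 - gibbsMarginal P Q k f y)
      = toL2 Q fun y => f y + L⁻¹ * (1 - gibbsMarginal P Q k f y) := by
    rw [toL2_add mf (mg.const_mul _), toL2_const_mul _ mg]
  refine projected_step_bound (Jy := dualObjective P Q k f)
    (g := toL2 Q fun y => 1 - gibbsMarginal P Q k f y) hL0 ?_ ?_ ?_
  · rw [hinner mp, norm_toL2_sub_sq mp mf, hL]
    exact (dualObjective_bounds hk hk0 hint hf hp hfR hpR).2
  · rw [hinner mχ]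
    exact (dualObjective_bounds hk hk0 hint hf hχ hfR hχR).1
  · intro s hs hs1
    have mdir : MemLp (fun y => χ y - p y) 2 Q := mχ.sub mp
    have mcomb : MemLp (fun y => p y + s * (χ y - p y)) 2 Q := mp.add (mdir.const_mul _)
    rw [etarget, ← toL2_sub mχ mp, ← toL2_const_mul _ mdir, ← toL2_add mp (mdir.const_mul _),
      norm_toL2_sub_sq mp mtarget, norm_toL2_sub_sq mcomb mtarget]
    exact hmin s hs hs1

section Density

/-- The measure with Lebesgue density `ρ`. -/
def densityMeasure (ρ : (Fin d → ℝ) → ℝ) : Measure (Fin d → ℝ) :=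
  volume.withDensity fun x => ENNReal.ofReal (ρ x)

variable {μ ν : (Fin d → ℝ) → ℝ} {c : (Fin d → ℝ) → (Fin d → ℝ) → ℝ} {ε : ℝ}

lemma integral_densityMeasure (hμ0 : ∀ x, 0 ≤ μ x) (hμm : Measurable μ) (f : (Fin d → ℝ) → ℝ) :
    ∫ x, f x ∂(densityMeasure μ) = ∫ x, f x * μ x := by
  rw [densityMeasure, integral_withDensity_eq_integral_toReal_smul hμm.ennreal_ofReal (by simp)]
  simp [hμ0, mul_comm]

lemma isProbabilityMeasure_densityMeasure (hμ0 : ∀ x, 0 ≤ μ x) (hμ1 : (∫ x, μ x) = 1) :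
    IsProbabilityMeasure (densityMeasure μ) := by
  have hi : Integrable μ := by
    by_contra h
    rw [integral_undef h] at hμ1
    exact zero_ne_one hμ1
  constructor
  rw [densityMeasure, withDensity_apply _ MeasurableSet.univ, setLIntegral_univ,
    ← ofReal_integral_eq_lintegral_ofReal hi (ae_of_all _ hμ0), hμ1, ENNReal.ofReal_one]

lemma densityMeasure_prod (hμm : Measurable μ) (hνm : Measurable ν) :
    (densityMeasure μ).prod (densityMeasure ν)
      = volume.withDensity fun z : (Fin d → ℝ) × (Fin d → ℝ) =>
          ENNReal.ofReal (μ z.1) * ENNReal.ofReal (ν z.2) :=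
  prod_withDensity hμm.ennreal_ofReal hνm.ennreal_ofReal

lemma integrable_densityMeasure_prod (hμ0 : ∀ x, 0 ≤ μ x) (hν0 : ∀ y, 0 ≤ ν y)
    (hμm : Measurable μ) (hνm : Measurable ν) {f : (Fin d → ℝ) × (Fin d → ℝ) → ℝ}
    (hf : Integrable fun z : (Fin d → ℝ) × (Fin d → ℝ) => f z * μ z.1 * ν z.2) :
    Integrable f ((densityMeasure μ).prod (densityMeasure ν)) := by
  rw [densityMeasure_prod hμm hνm, integrable_withDensity_iff_integrable_smul'
    (by fun_prop) (ae_of_all _ fun z => ENNReal.mul_lt_top (by simp) (by simp))]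
  refine hf.congr (ae_of_all _ fun z => ?_)
  simp [hμ0, hν0]; ring

lemma integral_densityMeasure_prod (hμ0 : ∀ x, 0 ≤ μ x) (hν0 : ∀ y, 0 ≤ ν y)
    (hμm : Measurable μ) (hνm : Measurable ν) (f : (Fin d → ℝ) × (Fin d → ℝ) → ℝ) :
    ∫ z, f z ∂((densityMeasure μ).prod (densityMeasure ν))
      = ∫ z : (Fin d → ℝ) × (Fin d → ℝ), f z * μ z.1 * ν z.2 := by
  rw [densityMeasure_prod hμm hνm, integral_withDensity_eq_integral_toReal_smul
    (by fun_prop) (ae_of_all _ fun z => ENNReal.mul_lt_top (by simp) (by simp))]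
  refine integral_congr_ae (ae_of_all _ fun z => ?_)
  simp [hμ0, hν0]; ring

lemma phiPlus_eq_logPartition (hν0 : ∀ y, 0 ≤ ν y) (hνm : Measurable ν) (φ : (Fin d → ℝ) → ℝ) :
    phiPlus ν c ε φ = logPartition (densityMeasure ν) (fun x y => c x y / ε) φ := by
  ext x
  rw [phiPlus, logPartition, integral_densityMeasure hν0 hνm]

lemma semiDual_eq_dualObjective (hμ0 : ∀ x, 0 ≤ μ x) (hν0 : ∀ y, 0 ≤ ν y)
    (hμm : Measurable μ) (hνm : Measurable ν) (φ : (Fin d → ℝ) → ℝ) :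
    semiDual μ ν c ε φ
      = dualObjective (densityMeasure μ) (densityMeasure ν) (fun x y => c x y / ε) φ := by
  rw [semiDual, dualObjective, phiPlus_eq_logPartition hν0 hνm, integral_densityMeasure hν0 hνm,
    integral_densityMeasure hμ0 hμm]

lemma deltaJ_div_eq (hμ0 : ∀ x, 0 ≤ μ x) (hν0 : ∀ y, 0 ≤ ν y)
    (hμm : Measurable μ) (hνm : Measurable ν) (φ : (Fin d → ℝ) → ℝ) {y : Fin d → ℝ}
    (hy : ν y ≠ 0) :
    deltaJ μ ν c ε φ y / ν y
      = 1 - gibbsMarginal (densityMeasure μ) (densityMeasure ν) (fun x y => c x y / ε) φ y := by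
  simp only [deltaJ, piY, piJoint]
  rw [integral_mul_const, phiPlus_eq_logPartition hν0 hνm, gibbsMarginal,
    integral_densityMeasure hμ0 hμm, sub_div, div_self hy, mul_div_cancel_right₀ _ hy]

lemma integral_sub_gradient_step_sq (hμ0 : ∀ x, 0 ≤ μ x) (hν0 : ∀ y, 0 ≤ ν y)
    (hμm : Measurable μ) (hνm : Measurable ν) (φ χ : (Fin d → ℝ) → ℝ) (η : ℝ) :
    ∫ y, (χ y - (φ y + η * (deltaJ μ ν c ε φ y / ν y))) ^ 2 * ν y
      = ∫ y, (χ y - (φ y + η * (1 - gibbsMarginal (densityMeasure μ) (densityMeasure ν)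
          (fun x y => c x y / ε) φ y))) ^ 2 ∂(densityMeasure ν) := by
  rw [integral_densityMeasure hν0 hνm]
  refine integral_congr_ae (ae_of_all _ fun y => ?_)
  by_cases hy : ν y = 0
  · simp [hy]
  · simp only [deltaJ_div_eq hμ0 hν0 hμm hνm φ hy]

end Density

/-- Accelerated rate for momentum-equipped projected semi-dual ascent.
With the FISTA-style iteration `φ̄^n = M(φ^n; λ(3B)⁻¹)`,
`t_{n+1} = (1 + √(1+4t_n²))/2`, `φ^{n+1} = φ̄^n + ((t_n−1)/t_{n+1})(φ̄^n − φ̄^{n−1})`,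
starting from `φ¹ = φ̄⁰ ∈ S_B`, `t₁ = 1`, and `φ̃*` a maximizer of `J` over `S_B`,
for every `N ≥ 1`: `J(φ̄^N) − J(φ̃*) ≥ −2λ(3B)‖φ̄⁰ − φ̃*‖²_{L²(ν)}/(N+1)²`. -/
theorem accelerated_projSGA_rate
    (μ ν : (Fin d → ℝ) → ℝ) (c : (Fin d → ℝ) → (Fin d → ℝ) → ℝ) (ε : ℝ)
    (hε : 0 < ε) (hμ0 : ∀ x, 0 ≤ μ x) (hν0 : ∀ y, 0 ≤ ν y)
    (hμm : Measurable μ) (hνm : Measurable ν)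
    (hμ1 : (∫ x, μ x) = 1) (hν1 : (∫ y, ν y) = 1)
    (hc : Measurable (Function.uncurry c))
    (hc0 : ∀ x y, 0 ≤ c x y)
    (B : ℝ) (hB : 0 < B)
    (hlamfin : Integrable
      (fun z : (Fin d → ℝ) × (Fin d → ℝ) => Real.exp (c z.1 z.2 / ε) * μ z.1 * ν z.2))
    (SB : Set ((Fin d → ℝ) → ℝ))
    (hSB : SB = {ψ | Measurable ψ ∧ ∀ᵐ y ∂(volume : Measure (Fin d → ℝ)), |ψ y| ≤ B})
    (M : ((Fin d → ℝ) → ℝ) → ℝ → ((Fin d → ℝ) → ℝ))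
    (hM : ∀ ψ : (Fin d → ℝ) → ℝ, Measurable ψ →
      (∀ᵐ y ∂(volume : Measure (Fin d → ℝ)), |ψ y| ≤ 3 * B) →
      ∀ η : ℝ, 0 < η → M ψ η ∈ SB ∧ ∀ χ ∈ SB,
        (∫ y, (M ψ η y - (ψ y + η * (deltaJ μ ν c ε ψ y / ν y))) ^ 2 * ν y) ≤
          ∫ y, (χ y - (ψ y + η * (deltaJ μ ν c ε ψ y / ν y))) ^ 2 * ν y)
    (φ φbar : ℕ → (Fin d → ℝ) → ℝ) (t : ℕ → ℝ)
    (hinit : φ 1 = φbar 0) (hbar0 : φbar 0 ∈ SB) (ht1 : t 1 = 1)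
    (hbar : ∀ n : ℕ, 1 ≤ n → φbar n = M (φ n) (lamB μ ν c ε (3 * B))⁻¹)
    (ht : ∀ n : ℕ, 1 ≤ n → t (n + 1) = (1 + Real.sqrt (1 + 4 * t n ^ 2)) / 2)
    (hmom : ∀ n : ℕ, 1 ≤ n → φ (n + 1) = fun y =>
      φbar n y + ((t n - 1) / t (n + 1)) * (φbar n y - φbar (n - 1) y))
    (φstar : (Fin d → ℝ) → ℝ) (hφstarS : φstar ∈ SB)
    (hmax : ∀ ψ ∈ SB, semiDual μ ν c ε ψ ≤ semiDual μ ν c ε φstar) :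
    ∀ N : ℕ, 1 ≤ N →
      semiDual μ ν c ε (φbar N) - semiDual μ ν c ε φstar ≥
        -(2 * lamB μ ν c ε (3 * B) * ∫ y, (φbar 0 y - φstar y) ^ 2 * ν y) / (N + 1) ^ 2 := by
  have hP := isProbabilityMeasure_densityMeasure hμ0 hμ1
  have hQ := isProbabilityMeasure_densityMeasure hν0 hν1
  have hac : densityMeasure ν ≪ volume := withDensity_absolutelyContinuous _ _
  have hk : Measurable (Function.uncurry fun x y => c x y / ε) := hc.div_const ε
  have hk0 : ∀ x y, 0 ≤ c x y / ε := fun x y => div_nonneg (hc0 x y) hε.le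
  have hint := integrable_densityMeasure_prod hμ0 hν0 hμm hνm
    (f := fun z => Real.exp (c z.1 z.2 / ε)) hlamfin
  set L := lamB μ ν c ε (3 * B) with hLdef
  have hL : L = Real.exp (2 * (3 * B)) * ∫ z : (Fin d → ℝ) × (Fin d → ℝ),
      Real.exp (c z.1 z.2 / ε) ∂((densityMeasure μ).prod (densityMeasure ν)) := by
    rw [hLdef, lamB, integral_densityMeasure_prod hμ0 hν0 hμm hνm]
  have hL0 : 0 < L := by
    rw [hL]
    exact mul_pos (Real.exp_pos _) (integral_exp_pos hint)
  have hSB_iff : ∀ ψ, ψ ∈ SB ↔ Measurable ψ ∧ ∀ᵐ y, |ψ y| ≤ B := by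
    intro ψ
    rw [hSB]; rfl
  have hmem : ∀ n : ℕ, φbar n ∈ SB ∧ Measurable (φ (n + 1)) ∧ ∀ᵐ y, |φ (n + 1) y| ≤ 3 * B := by
    intro n
    induction n with
    | zero =>
      have h0 := (hSB_iff _).1 hbar0
      rw [zero_add, hinit]
      exact ⟨hbar0, h0.1, h0.2.mono fun y hy => by linarith⟩
    | succ n ih =>
      have hnew : φbar (n + 1) ∈ SB := by
        rw [hbar (n + 1) (by omega)]
        exact (hM _ ih.2.1 ih.2.2 _ (inv_pos.2 hL0)).1
      obtain ⟨m1, b1⟩ := (hSB_iff _).1 hnew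
      obtain ⟨m0, b0⟩ := (hSB_iff _).1 ih.1
      rw [hmom (n + 1) (by omega), Nat.add_sub_cancel]
      refine ⟨hnew, m1.add ((m1.sub m0).const_mul _), ?_⟩
      have ht1' := momentum_coeff_ge ht1 ht (n + 1) (by omega)
      have hsq := momentum_coeff_sq ht (n + 1) (by omega)
      have ht2' := momentum_coeff_ge ht1 ht (n + 1 + 1) (by omega)
      have hn0 : (0 : ℝ) ≤ n := n.cast_nonneg
      push_cast at ht1' ht2'
      have hθ0 : 0 ≤ (t (n + 1) - 1) / t (n + 1 + 1) := div_nonneg (by linarith) (by linarith)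
      have hθ1 : (t (n + 1) - 1) / t (n + 1 + 1) ≤ 1 := by
        rw [div_le_one (by linarith)]
        nlinarith
      filter_upwards [b1, b0] with y h1 h0
      have h2 : |(t (n + 1) - 1) / t (n + 1 + 1) * (φbar (n + 1) y - φbar n y)|
          ≤ 1 * (B + B) := by
        rw [abs_mul, abs_of_nonneg hθ0]
        exact mul_le_mul hθ1 ((abs_sub _ _).trans (add_le_add h1 h0)) (abs_nonneg _) zero_le_one
      exact (abs_add_le _ _).trans (by linarith)
  have hstep : ∀ n : ℕ, 1 ≤ n → ∀ χ ∈ SB,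
      L / 2 * (‖toL2 (densityMeasure ν) (φbar n) - toL2 (densityMeasure ν) χ‖ ^ 2
          - ‖toL2 (densityMeasure ν) (φ n) - toL2 (densityMeasure ν) χ‖ ^ 2)
        ≤ semiDual μ ν c ε (φbar n) - semiDual μ ν c ε χ := by
    intro n hn χ hχ
    obtain ⟨m, rfl⟩ := Nat.exists_eq_add_of_le' hn
    obtain ⟨mφ, bφ⟩ := (hmem m).2
    obtain ⟨mp, bp⟩ := (hSB_iff _).1 (hmem (m + 1)).1
    obtain ⟨mχ, bχ⟩ := (hSB_iff _).1 hχ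
    rw [semiDual_eq_dualObjective hμ0 hν0 hμm hνm, semiDual_eq_dualObjective hμ0 hν0 hμm hνm]
    refine dualObjective_projected_step hk hk0 hint hL hL0 mφ mp mχ (hac bφ)
      (hac (bp.mono fun y hy => by linarith)) (hac (bχ.mono fun y hy => by linarith)) ?_
    intro s hs hs1
    have hcomb : (fun y => φbar (m + 1) y + s * (χ y - φbar (m + 1) y)) ∈ SB := by
      refine (hSB_iff _).2 ⟨mp.add ((mχ.sub mp).const_mul s), ?_⟩
      filter_upwards [bp, bχ] with y h1 h2
      rw [abs_le] at h1 h2 ⊢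
      constructor <;> nlinarith
    have h := (hM _ mφ bφ _ (inv_pos.2 hL0)).2 _ hcomb
    rw [← hbar (m + 1) hn] at h
    rwa [integral_sub_gradient_step_sq hμ0 hν0 hμm hνm,
      integral_sub_gradient_step_sq hμ0 hν0 hμm hνm] at h
  have hmemLp : ∀ χ ∈ SB, MemLp χ 2 (densityMeasure ν) := fun χ hχ =>
    memLp_of_ae_abs_le ((hSB_iff _).1 hχ).1 (hac ((hSB_iff _).1 hχ).2)
  intro N hN
  have hrate := accelerated_rate_of_step_bounds
    (x := fun n => toL2 (densityMeasure ν) (φbar n)) (y := fun n => toL2 (densityMeasure ν) (φ n))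
    (xs := toL2 (densityMeasure ν) φstar) (v := fun n => semiDual μ ν c ε (φbar n))
    (vs := semiDual μ ν c ε φstar) hL0 (by simp only [hinit]) ht1 ht ?_
    (fun n hn => hstep n hn _ hφstarS) (fun n hn => hstep n hn _ (hmem (n - 1)).1) N hN
  · rwa [norm_toL2_sub_sq (hmemLp _ hbar0) (hmemLp _ hφstarS),
      integral_densityMeasure hν0 hνm] at hrate
  · intro n hn
    have m1 := hmemLp _ (hmem n).1
    have m0 := hmemLp _ (hmem (n - 1)).1
    have mdir : MemLp (fun y => φbar n y - φbar (n - 1) y) 2 (densityMeasure ν) := m1.sub m0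
    simp only [hmom n hn]
    rw [toL2_add m1 (mdir.const_mul _), toL2_const_mul _ mdir, toL2_sub m1 m0]
end
end
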